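/- arXiv:2602.09058 — 3 statements merged into one kernel-verified Lean document; each statement's English description precedes it below -/
import Mathlib

section
/- Let δ > 0, let m₋ ≥ 1 and m₊ ≥ 1 be natural numbers, and let ℓ₋ : Fin m₋ → ℝ and ℓ₊ : Fin m₊ → ℝ be lifetime vectors with all coordinates positive. Assume macroscopic feature separation: there exists an index i⋆ with ℓ₋ i⋆ ≥ δ and ℓ₋ i⋆ < ∑ i, ℓ₋ i, and moreover PE(ℓ₊) < -p⋆ * Real.log p⋆, where p⋆ = ℓ₋ i⋆ / ∑ i, ℓ₋ i. Let (Ω, μ) be a probability space and let X_N⁻ : Ω → (Fin m₋ → ℝ) and X_N⁺ : Ω → (Fin m₊ → ℝ) be sequences of measurable maps that converge in probability to the constant limits ℓ₋ and ℓ₊ respectively. Then there exists a constant Δ > 0 such that μ {ω | PE(X_N⁺ ω) + Δ ≤ PE(X_N⁻ ω)} tends to 1 as N → ∞; that is, persistent entropy separates the two phases with an asymptotically non-vanishing gap. -/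
open MeasureTheory Filter Topology

/-- Persistent entropy of a lifetime vector: Shannon entropy of the normalized
lifetime distribution (with Lean's total division). -/
noncomputable def PE {m : ℕ} (ℓ : Fin m → ℝ) : ℝ :=
  -∑ i, (ℓ i / ∑ j, ℓ j) * Real.log (ℓ i / ∑ j, ℓ j)

theorem PE_eq_sum_negMulLog {m : ℕ} (ℓ : Fin m → ℝ) :
    PE ℓ = ∑ i, Real.negMulLog (ℓ i / ∑ j, ℓ j) := by
  simp [PE, Real.negMulLog]

theorem continuousAt_PE {m : ℕ} {ℓ : Fin m → ℝ} (hℓ : ∑ i, ℓ i ≠ 0) : ContinuousAt PE ℓ := by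
  have hPE : (PE : (Fin m → ℝ) → ℝ) = fun x => ∑ i, Real.negMulLog (x i / ∑ j, x j) :=
    funext PE_eq_sum_negMulLog
  rw [hPE]
  refine tendsto_finsetSum _ fun i _ => ?_
  exact Real.continuous_negMulLog.continuousAt.comp
    (f := fun x : Fin m → ℝ => x i / ∑ j, x j)
    (ContinuousAt.div (continuous_apply i).continuousAt (by fun_prop) hℓ)

/-- Each single-coordinate entropy contribution is a lower bound for the persistent entropy. -/
theorem negMulLog_div_sum_le_PE {m : ℕ} {ℓ : Fin m → ℝ} (hℓ : ∀ i, 0 ≤ ℓ i) (i : Fin m) :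
    Real.negMulLog (ℓ i / ∑ j, ℓ j) ≤ PE ℓ := by
  rw [PE_eq_sum_negMulLog]
  have hsum : 0 ≤ ∑ j, ℓ j := Finset.sum_nonneg fun j _ => hℓ j
  refine Finset.single_le_sum (f := fun i => Real.negMulLog (ℓ i / ∑ j, ℓ j))
    (fun k _ => Real.negMulLog_nonneg (div_nonneg (hℓ k) hsum) ?_) (Finset.mem_univ i)
  exact div_le_one_of_le₀ (Finset.single_le_sum (fun j _ => hℓ j) (Finset.mem_univ k)) hsum

/-- If `X` converges in measure to a constant `c`, the measure of the event that a property
holding near `c` fails along `X` tends to zero. -/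
theorem tendsto_measure_not_of_tendstoInMeasure_const {Ω ι E : Type*} [MeasurableSpace Ω]
    [PseudoEMetricSpace E] {μ : Measure Ω} {l : Filter ι} {X : ι → Ω → E} {c : E}
    (hX : TendstoInMeasure μ X l fun _ => c) {p : E → Prop} (hp : ∀ᶠ x in 𝓝 c, p x) :
    Tendsto (fun i => μ {ω | ¬ p (X i ω)}) l (𝓝 0) := by
  obtain ⟨ε, hε, hball⟩ := EMetric.mem_nhds_iff.1 hp
  refine tendsto_of_tendsto_of_tendsto_of_le_of_le tendsto_const_nhds (hX ε hε)
    (fun _ => zero_le) fun i => measure_mono fun ω hω => ?_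
  by_contra hlt
  exact hω (hball (Metric.mem_eball.2 (not_le.1 hlt)))

theorem tendsto_measure_one_of_tendsto_compl {Ω ι : Type*} [MeasurableSpace Ω]
    {μ : Measure Ω} [IsProbabilityMeasure μ] {l : Filter ι} {s : ι → Set Ω}
    (hs : Tendsto (fun i => μ (s i)ᶜ) l (𝓝 0)) : Tendsto (fun i => μ (s i)) l (𝓝 1) := by
  have hlower : Tendsto (fun i => 1 - μ (s i)ᶜ) l (𝓝 1) := by
    simpa using ENNReal.Tendsto.sub (tendsto_const_nhds (x := (1 : ENNReal))) hs (by simp)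
  refine tendsto_of_tendsto_of_tendsto_of_le_of_le hlower tendsto_const_nhds
    (fun i => ?_) fun i => prob_le_one
  rw [tsub_le_iff_right, ← measure_univ (μ := μ), ← Set.union_compl_self (s i)]
  exact measure_union_le _ _

/-- Persistent entropy separates the two phases with an asymptotically
non-vanishing gap. -/
theorem persistent_entropy_separates_phases
    {Ω : Type*} [MeasurableSpace Ω] (μ : Measure Ω) [IsProbabilityMeasure μ]
    (δ : ℝ) (hδ : 0 < δ) (mneg mpos : ℕ) (hmneg : 1 ≤ mneg) (hmpos : 1 ≤ mpos)
    (ℓneg : Fin mneg → ℝ) (ℓpos : Fin mpos → ℝ)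
    (hposneg : ∀ i, 0 < ℓneg i) (hpospos : ∀ i, 0 < ℓpos i)
    (istar : Fin mneg) (histar : δ ≤ ℓneg istar) (hlt : ℓneg istar < ∑ i, ℓneg i)
    (hPEpos : PE ℓpos <
      -(ℓneg istar / ∑ i, ℓneg i) * Real.log (ℓneg istar / ∑ i, ℓneg i))
    (Xneg : ℕ → Ω → (Fin mneg → ℝ)) (Xpos : ℕ → Ω → (Fin mpos → ℝ))
    (hmeasneg : ∀ N, Measurable (Xneg N)) (hmeaspos : ∀ N, Measurable (Xpos N))
    (hconvneg : TendstoInMeasure μ Xneg atTop (fun _ => ℓneg))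
    (hconvpos : TendstoInMeasure μ Xpos atTop (fun _ => ℓpos)) :
    ∃ Δ : ℝ, 0 < Δ ∧
      Tendsto (fun N => μ {ω | PE (Xpos N ω) + Δ ≤ PE (Xneg N ω)}) atTop (𝓝 1) := by
  have hneg_sum : 0 < ∑ i, ℓneg i := (hposneg istar).trans hlt
  have hpos_sum : 0 < ∑ i, ℓpos i :=
    Finset.sum_pos (fun i _ => hpospos i) ⟨⟨0, hmpos⟩, Finset.mem_univ _⟩
  have hgap : PE ℓpos < PE ℓneg :=
    hPEpos.trans_le (negMulLog_div_sum_le_PE (fun i => (hposneg i).le) istar)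
  refine ⟨(PE ℓneg - PE ℓpos) / 3, by linarith, tendsto_measure_one_of_tendsto_compl ?_⟩
  have hneg := tendsto_measure_not_of_tendstoInMeasure_const hconvneg
    ((continuousAt_PE hneg_sum.ne').eventually
      (lt_mem_nhds (by linarith : PE ℓneg - (PE ℓneg - PE ℓpos) / 3 < PE ℓneg)))
  have hpos := tendsto_measure_not_of_tendstoInMeasure_const hconvpos
    ((continuousAt_PE hpos_sum.ne').eventually
      (gt_mem_nhds (by linarith : PE ℓpos < PE ℓpos + (PE ℓneg - PE ℓpos) / 3)))
  refine tendsto_of_tendsto_of_tendsto_of_le_of_le tendsto_const_nhds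
    (by simpa using hneg.add hpos) (fun _ => zero_le) fun N =>
      (measure_mono fun ω hω => ?_).trans (measure_union_le _ _)
  by_contra hgood
  obtain ⟨hgood_neg, hgood_pos⟩ := not_or.1 hgood
  have hlow : PE ℓneg - (PE ℓneg - PE ℓpos) / 3 < PE (Xneg N ω) := not_le.1 hgood_neg
  have hupp : PE (Xpos N ω) < PE ℓpos + (PE ℓneg - PE ℓpos) / 3 := not_le.1 hgood_pos
  have hsep : PE (Xpos N ω) + (PE ℓneg - PE ℓpos) / 3 ≤ PE (Xneg N ω) := by linarith
  exact hω hsep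
end

section
/- For n ≥ 1 let ℓ⁽ⁿ⁾ : Fin (n+1) → ℝ be the lifetime vector with ℓ⁽ⁿ⁾ 0 = 1 and ℓ⁽ⁿ⁾ i = 1/n for every i ≠ 0. Then PE(ℓ⁽ⁿ⁾) = Real.log 2 + (1/2) * Real.log n; in particular PE(ℓ⁽ⁿ⁾) → ∞ as n → ∞, even though every added bar has lifetime 1/n → 0. Hence adding arbitrarily many near-diagonal bars of arbitrarily small lifetime changes persistent entropy by an unbounded amount, so persistent entropy is not uniformly continuous on the space of all lifetime vectors. -/
open Filter

/-- The lifetime vector with one bar of length `1` and `n` bars of length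
`1/n`. -/
noncomputable def nearDiagonal (n : ℕ) : Fin (n + 1) → ℝ :=
  fun i => if i = 0 then 1 else 1 / n

theorem sum_nearDiagonal {n : ℕ} (hn : n ≠ 0) : ∑ i, nearDiagonal n i = 2 := by
  have hn' : (n : ℝ) ≠ 0 := Nat.cast_ne_zero.mpr hn
  simp only [nearDiagonal, Fin.sum_univ_succ, Fin.succ_ne_zero, if_true, if_false,
    Finset.sum_const, Finset.card_univ, Fintype.card_fin, nsmul_eq_mul]
  field_simp
  norm_num

theorem PE_nearDiagonal {n : ℕ} (hn : n ≠ 0) :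
    PE (nearDiagonal n) = Real.log 2 + (1 / 2) * Real.log n := by
  have hn' : (n : ℝ) ≠ 0 := Nat.cast_ne_zero.mpr hn
  have hlog : Real.log (1 / n / 2) = -(Real.log n + Real.log 2) := by
    rw [div_div, one_div, Real.log_inv, Real.log_mul hn' two_ne_zero]
  have hlog_half : Real.log (1 / 2) = -Real.log 2 := by
    rw [one_div, Real.log_inv]
  rw [PE, sum_nearDiagonal hn]
  simp only [nearDiagonal, Fin.sum_univ_succ, Fin.succ_ne_zero, if_true, if_false,
    Finset.sum_const, Finset.card_univ, Fintype.card_fin, nsmul_eq_mul]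
  rw [hlog, hlog_half]
  field_simp
  ring

/-- Adding `n` near-diagonal bars of lifetime `1/n` to a single unit bar yields
persistent entropy `log 2 + (1/2) log n`, which tends to infinity; hence
persistent entropy is unstable under the creation of arbitrarily many
near-diagonal bars of arbitrarily small lifetime. -/
theorem PE_nearDiagonal_unbounded :
    (∀ n : ℕ, 1 ≤ n →
      PE (nearDiagonal n) = Real.log 2 + (1 / 2) * Real.log n) ∧
    Tendsto (fun n : ℕ => PE (nearDiagonal n)) atTop atTop := by
  refine ⟨fun n hn => PE_nearDiagonal (Nat.one_le_iff_ne_zero.mp hn), ?_⟩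
  have hlim : Tendsto (fun n : ℕ => Real.log 2 + (1 / 2) * Real.log n) atTop atTop :=
    tendsto_atTop_add_const_left _ _ <|
      (Real.tendsto_log_atTop.comp tendsto_natCast_atTop_atTop).const_mul_atTop one_half_pos
  refine hlim.congr' ?_
  filter_upwards [eventually_ne_atTop 0] with n hn
  exact (PE_nearDiagonal hn).symm
end

section
/- Let τ > 0, let m : ℕ, and define the truncated persistent entropy PE_τ(v) of v : Fin m → ℝ as the Shannon entropy of the normalized weights q i = v i / (∑_{j : v j > τ} v j) over the index set {i | v i > τ}, i.e. PE_τ(v) = -∑_{i : v i > τ} q i * Real.log (q i) (with Lean's total division). If ℓ : Fin m → ℝ satisfies ℓ i ≠ τ for every i and ℓ i⋆ > τ for at least one index i⋆, then PE_τ is continuous at ℓ. -/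
/-- Truncated persistent entropy at threshold `τ`: the Shannon entropy of the
normalized weights over the bars with lifetime exceeding `τ` (with Lean's total
division). -/
noncomputable def PEtrunc (τ : ℝ) {m : ℕ} (v : Fin m → ℝ) : ℝ :=
  -∑ i ∈ Finset.univ.filter (fun i => τ < v i),
    (v i / ∑ j ∈ Finset.univ.filter (fun j => τ < v j), v j) *
      Real.log (v i / ∑ j ∈ Finset.univ.filter (fun j => τ < v j), v j)

/-- If no coordinate of `ℓ` equals `τ`, the set of coordinates exceeding `τ` is locally constant
at `ℓ`. -/
theorem eventually_filter_lt_eq {ι : Type*} [Fintype ι] {τ : ℝ} {ℓ : ι → ℝ}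
    (hne : ∀ i, ℓ i ≠ τ) :
    ∀ᶠ v : ι → ℝ in nhds ℓ,
      Finset.univ.filter (fun i => τ < v i) = Finset.univ.filter (fun i => τ < ℓ i) := by
  have h : ∀ i, ∀ᶠ v : ι → ℝ in nhds ℓ, (τ < v i ↔ τ < ℓ i) := by
    intro i
    have hc : ContinuousAt (fun v : ι → ℝ => v i) ℓ := (continuous_apply i).continuousAt
    rcases lt_or_gt_of_ne (hne i) with hi | hi
    · filter_upwards [hc.eventually_lt_const hi] with v hv
      exact iff_of_false hv.not_gt hi.not_gt
    · filter_upwards [hc.eventually_const_lt hi] with v hv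
      exact iff_of_true hv hi
  filter_upwards [Filter.eventually_all.2 h] with v hv
  exact Finset.filter_congr fun i _ => hv i

/-- The Shannon entropy of the weights normalized over a fixed index set is continuous wherever
their total is nonzero. -/
theorem continuousAt_entropy_div_sum {ι : Type*} (s : Finset ι) {ℓ : ι → ℝ}
    (hs : ∑ j ∈ s, ℓ j ≠ 0) :
    ContinuousAt (fun v : ι → ℝ =>
      -∑ i ∈ s, (v i / ∑ j ∈ s, v j) * Real.log (v i / ∑ j ∈ s, v j)) ℓ := by
  have hq : ∀ i, ContinuousAt (fun v : ι → ℝ => v i / ∑ j ∈ s, v j) ℓ := fun i =>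
    (continuous_apply i).continuousAt.div (by fun_prop) hs
  exact (tendsto_finsetSum s fun i _ =>
    Real.continuous_mul_log.continuousAt.comp (hq i)).neg

/-- If no lifetime equals the threshold `τ` and at least one lifetime exceeds
`τ`, then the truncated persistent entropy is continuous at `ℓ`. -/
theorem PEtrunc_continuousAt {τ : ℝ} (hτ : 0 < τ) {m : ℕ} (ℓ : Fin m → ℝ)
    (hne : ∀ i, ℓ i ≠ τ) (hex : ∃ istar : Fin m, τ < ℓ istar) :
    ContinuousAt (PEtrunc τ (m := m)) ℓ := by
  have hs : ∑ j ∈ Finset.univ.filter (fun j => τ < ℓ j), ℓ j ≠ 0 := by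
    obtain ⟨k, hk⟩ := hex
    exact (Finset.sum_pos (fun i hi => hτ.trans (Finset.mem_filter.1 hi).2)
      ⟨k, by simpa using hk⟩).ne'
  refine (continuousAt_entropy_div_sum _ hs).congr ?_
  filter_upwards [eventually_filter_lt_eq hne] with v hv
  rw [PEtrunc, hv]
end
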